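/- Fix a mollifier ψ ∈ C_c^∞(ℝ³) supported in the unit ball with ∫ψ = 1, σ > 0, ψ_σ(x)=σ^{−3}ψ(x/σ), and Φ_σ[g] = ψ_σ ⋆ g (spatial convolution). Let F(p)=(|p|²−1)², f(p)=∇F(p)=4(|p|²−1)p, let T>0, and let z, v, d : ℝ³×[0,T] → ℝ³ and π : ℝ³×[0,T] → ℝ be smooth and ℤ³-periodic in the space variable with div v = 0 and div z = 0, solving the approximate Ericksen–Leslie system ∂_t v − Δv + (z+Φ_σ[v])·∇(z+v) + ∇π = −(∇Φ_σ[d])ᵀ(Δd − f(d)) and ∂_t d + (z+v)·∇Φ_σ[d] = Δd − f(d). Then for every t ∈ (0,T), (d/dt)∫_{[0,1]³}(½|v|² + ½|∇d|² + F(d)) dx + ∫_{[0,1]³}(|∇v|² + |Δd−f(d)|²) dx = ∫_{[0,1]³}[((z+Φ_σ[v])·∇v)·z] dx + ∫_{[0,1]³}((z·∇)Φ_σ[d])·(Δd − f(d)) dx. -/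

import Mathlib

open MeasureTheory

/-- Partial derivative in direction `i` of a scalar function on `ℝ³`. -/
noncomputable def pd (i : Fin 3) (g : (Fin 3 → ℝ) → ℝ) (x : Fin 3 → ℝ) : ℝ :=
  fderiv ℝ g x (Pi.single i 1)

/-- Spatial mollification `(ψ ⋆ g)(x) = ∫ ψ(x−y) g(y) dy` of a vector field. -/
noncomputable def mollify (ψ : (Fin 3 → ℝ) → ℝ) (g : (Fin 3 → ℝ) → (Fin 3 → ℝ))
    (x : Fin 3 → ℝ) : Fin 3 → ℝ :=
  ∫ y, ψ (x - y) • g y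

open scoped ContDiff Convolution

/-- Invariance of a scalar function on `ℝ³` under translations by `ℤ³`. -/
def LatticePeriodic (g : (Fin 3 → ℝ) → ℝ) : Prop :=
  ∀ (x : Fin 3 → ℝ) (n : Fin 3 → ℤ), g (x + fun i => (n i : ℝ)) = g x

theorem LatticePeriodic.pd {g : (Fin 3 → ℝ) → ℝ} (hg : LatticePeriodic g) (i : Fin 3) :
    LatticePeriodic (pd i g) := by
  intro x n
  unfold _root_.pd
  rw [← fderiv_comp_add_right]
  congr 2
  funext y
  exact hg y n

theorem contDiff_pd {g : (Fin 3 → ℝ) → ℝ} (hg : ContDiff ℝ ∞ g) (i : Fin 3) :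
    ContDiff ℝ ∞ (pd i g) :=
  (hg.fderiv_right (m := ∞) (by simp)).clm_apply contDiff_const

theorem pd_mul {f g : (Fin 3 → ℝ) → ℝ} (hf : ContDiff ℝ ∞ f) (hg : ContDiff ℝ ∞ g)
    (i : Fin 3) (x : Fin 3 → ℝ) :
    pd i (fun y => f y * g y) x = f x * pd i g x + pd i f x * g x := by
  unfold pd
  rw [fderiv_fun_mul (hf.differentiable (by simp) x) (hg.differentiable (by simp) x)]
  simp [mul_comm]

theorem pd_add {f g : (Fin 3 → ℝ) → ℝ} (hf : ContDiff ℝ ∞ f) (hg : ContDiff ℝ ∞ g)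
    (i : Fin 3) (x : Fin 3 → ℝ) :
    pd i (fun y => f y + g y) x = pd i f x + pd i g x := by
  unfold pd
  rw [fderiv_fun_add (hf.differentiable (by simp) x) (hg.differentiable (by simp) x)]
  simp

theorem pd_sub {f g : (Fin 3 → ℝ) → ℝ} (hf : ContDiff ℝ ∞ f) (hg : ContDiff ℝ ∞ g)
    (i : Fin 3) (x : Fin 3 → ℝ) :
    pd i (fun y => f y - g y) x = pd i f x - pd i g x := by
  unfold pd
  rw [fderiv_fun_sub (hf.differentiable (by simp) x) (hg.differentiable (by simp) x)]
  simp

theorem pd_sum {ι : Type*} (s : Finset ι) {f : ι → (Fin 3 → ℝ) → ℝ}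
    (hf : ∀ k, ContDiff ℝ ∞ (f k)) (i : Fin 3) (x : Fin 3 → ℝ) :
    pd i (fun y => ∑ k ∈ s, f k y) x = ∑ k ∈ s, pd i (f k) x := by
  unfold pd
  rw [fderiv_fun_sum fun k _ => (hf k).differentiable (by simp) x]
  simp

/-- The divergence of a smooth periodic vector field has zero mean. -/
theorem setIntegral_divergence_eq_zero {X : Fin 3 → (Fin 3 → ℝ) → ℝ}
    (hX : ∀ i, ContDiff ℝ ∞ (X i)) (hper : ∀ i, LatticePeriodic (X i)) :
    ∫ x in Set.Icc (0 : Fin 3 → ℝ) 1, ∑ i, pd i (X i) x = 0 := by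
  have hcont : Continuous fun x => ∑ i, pd i (X i) x :=
    continuous_finsetSum _ fun i _ => (contDiff_pd (hX i) i).continuous
  have h := integral_divergence_of_hasFDerivAt_off_countable' (E := ℝ) (0 : Fin 3 → ℝ) 1
    zero_le_one X (fun i => fderiv ℝ (X i)) ∅ Set.countable_empty
    (fun i => (hX i).continuous.continuousOn)
    (fun x _ i => ((hX i).differentiable (by simp) x).hasFDerivAt)
    (hcont.continuousOn.integrableOn_compact isCompact_Icc)
  refine h.trans (Finset.sum_eq_zero fun i _ => ?_)
  rw [sub_eq_zero]
  congr 1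
  funext x
  have e : (i.insertNth ((1 : Fin 3 → ℝ) i) x : Fin 3 → ℝ)
      = i.insertNth ((0 : Fin 3 → ℝ) i) x
        + fun j => (((Pi.single i 1 : Fin 3 → ℤ) j : ℤ) : ℝ) := by
    funext j
    refine i.succAboveCases ?_ (fun j => ?_) j
    · simp
    · simp
  rw [e, hper]

theorem mollify_apply {η : (Fin 3 → ℝ) → ℝ} (hη : Continuous η) (hc : HasCompactSupport η)
    {g : (Fin 3 → ℝ) → (Fin 3 → ℝ)} (hg : Continuous g) (x : Fin 3 → ℝ) (i : Fin 3) :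
    mollify η g x i
      = ((fun y => g y i) ⋆[ContinuousLinearMap.lsmul ℝ ℝ, volume] η) x := by
  have hint : Integrable fun y => η (x - y) • g y := by
    refine Continuous.integrable_of_hasCompactSupport (by fun_prop) ?_
    exact (hc.comp_homeomorph (Homeomorph.subLeft x)).smul_right
  unfold mollify
  rw [convolution_def, eval_integral fun i => hint.eval i]
  simp [mul_comm]

theorem contDiff_mollify {η : (Fin 3 → ℝ) → ℝ} (hη : ContDiff ℝ ∞ η) (hc : HasCompactSupport η)
    {g : (Fin 3 → ℝ) → (Fin 3 → ℝ)} (hg : Continuous g) (i : Fin 3) :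
    ContDiff ℝ ∞ fun x => mollify η g x i := by
  simp_rw [mollify_apply hη.continuous hc hg]
  exact hc.contDiff_convolution_right _
    (Continuous.locallyIntegrable (by fun_prop)) hη

theorem latticePeriodic_mollify (η : (Fin 3 → ℝ) → ℝ) {g : (Fin 3 → ℝ) → (Fin 3 → ℝ)}
    (hg : ∀ (x : Fin 3 → ℝ) (n : Fin 3 → ℤ), g (x + fun i => (n i : ℝ)) = g x) (i : Fin 3) :
    LatticePeriodic fun x => mollify η g x i := by
  intro x n
  refine congrFun ?_ i
  unfold mollify
  rw [← integral_add_right_eq_self _ (fun i => (n i : ℝ))]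
  simp_rw [hg, add_sub_add_right_eq_sub]

theorem pd_mollify {η : (Fin 3 → ℝ) → ℝ} (hη : ContDiff ℝ ∞ η) (hc : HasCompactSupport η)
    {g : (Fin 3 → ℝ) → (Fin 3 → ℝ)} (hg : ContDiff ℝ ∞ g) (i j : Fin 3) (x : Fin 3 → ℝ) :
    Integrable (fun y => pd j (fun w => g w i) y * η (x - y)) ∧
    pd j (fun y => mollify η g y i) x = ∫ y, pd j (fun w => g w i) y * η (x - y) := by
  have hgi : ContDiff ℝ ∞ fun w => g w i := contDiff_pi.1 hg i
  have hsub : HasCompactSupport fun y => η (x - y) :=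
    hc.comp_homeomorph (Homeomorph.subLeft x)
  have hηs : ContDiff ℝ ∞ fun y => η (x - y) := by fun_prop
  have h1 : Integrable (fun y => pd j (fun w => g w i) y * η (x - y)) :=
    ((contDiff_pd hgi j).continuous.mul hηs.continuous).integrable_of_hasCompactSupport
      hsub.mul_left
  refine ⟨h1, ?_⟩
  have hd : ∀ y, fderiv ℝ (fun y => η (x - y)) y (Pi.single j 1)
      = - fderiv ℝ η (x - y) (Pi.single j 1) := by
    intro y
    have h := (hη.differentiable (by simp) (x - y)).hasFDerivAt.comp y
      ((hasFDerivAt_id y).const_sub x)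
    change fderiv ℝ (η ∘ HSub.hSub x) y _ = _
    rw [h.fderiv]
    simp
  simp_rw [mollify_apply hη.continuous hc hg.continuous]
  unfold pd at *
  have hloc : LocallyIntegrable fun y => g y i := hgi.continuous.locallyIntegrable
  rw [(hc.hasFDerivAt_convolution_right _ hloc (hη.of_le (by simp)) x).fderiv,
    convolution_precompR_apply _ hloc (hc.fderiv ℝ) (hη.continuous_fderiv (by simp)),
    convolution_def]
  have hibp := integral_mul_fderiv_eq_neg_fderiv_mul_of_integrable (μ := volume)
    (f := fun y => g y i) (g := fun y => η (x - y)) (v := Pi.single j 1) h1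
    (Continuous.integrable_of_hasCompactSupport
      (hgi.continuous.mul (contDiff_pd hηs j).continuous)
      ((hsub.fderiv_apply ℝ _).mul_left))
    ((hgi.continuous.mul hηs.continuous).integrable_of_hasCompactSupport hsub.mul_left)
    (fun y _ => hgi.differentiable (by simp) y) (fun y _ => hηs.differentiable (by simp) y)
  simp_rw [hd, mul_neg, integral_neg, neg_inj] at hibp
  simpa using hibp

/-- Mollification preserves the divergence-free condition. -/
theorem divergence_mollify_eq_zero {η : (Fin 3 → ℝ) → ℝ} (hη : ContDiff ℝ ∞ η)
    (hc : HasCompactSupport η) {g : (Fin 3 → ℝ) → (Fin 3 → ℝ)} (hg : ContDiff ℝ ∞ g)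
    (hdiv : ∀ x, ∑ i : Fin 3, pd i (fun y => g y i) x = 0) (x : Fin 3 → ℝ) :
    ∑ i : Fin 3, pd i (fun y => mollify η g y i) x = 0 := by
  simp_rw [fun i => (pd_mollify hη hc hg i i x).2]
  rw [← integral_finsetSum _ fun i _ => (pd_mollify hη hc hg i i x).1]
  simp [← Finset.sum_mul, hdiv]

theorem contDiff_rescale {ψ : (Fin 3 → ℝ) → ℝ} (hψ : ContDiff ℝ ∞ ψ) (σ : ℝ) :
    ContDiff ℝ ∞ fun y : Fin 3 → ℝ => σ⁻¹ ^ 3 * ψ (σ⁻¹ • y) := by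
  fun_prop

theorem hasCompactSupport_rescale {ψ : (Fin 3 → ℝ) → ℝ}
    (hψ : tsupport ψ ⊆ {x : Fin 3 → ℝ | ∑ i : Fin 3, (x i) ^ 2 ≤ 1}) {σ : ℝ} (hσ : 0 < σ) :
    HasCompactSupport fun y : Fin 3 → ℝ => σ⁻¹ ^ 3 * ψ (σ⁻¹ • y) := by
  have h : HasCompactSupport ψ := by
    refine (isCompact_closedBall (0 : Fin 3 → ℝ) 1).of_isClosed_subset (isClosed_tsupport ψ) ?_
    intro x hx
    rw [mem_closedBall_zero_iff, pi_norm_le_iff_of_nonneg zero_le_one]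
    intro i
    rw [Real.norm_eq_abs, ← sq_le_one_iff_abs_le_one]
    exact (Finset.single_le_sum (f := fun i => (x i) ^ 2) (fun j _ => sq_nonneg _)
      (Finset.mem_univ i)).trans (hψ hx)
  exact (h.comp_smul (inv_ne_zero hσ.ne')).mul_left

/-- Differentiation under the integral sign over a compact set. -/
theorem hasDerivAt_setIntegral_of_continuousOn {K : Set (Fin 3 → ℝ)} (hK : IsCompact K)
    {a b : ℝ} {G G' : (Fin 3 → ℝ) × ℝ → ℝ}
    (hG : ContinuousOn G (Set.univ ×ˢ Set.Ioo a b))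
    (hG' : ContinuousOn G' (Set.univ ×ˢ Set.Ioo a b))
    (hderiv : ∀ x, ∀ s ∈ Set.Ioo a b, HasDerivAt (fun r => G (x, r)) (G' (x, s)) s)
    {t : ℝ} (ht : t ∈ Set.Ioo a b) :
    HasDerivAt (fun s => ∫ x in K, G (x, s)) (∫ x in K, G' (x, t)) t := by
  have hslice : ∀ {H : (Fin 3 → ℝ) × ℝ → ℝ}, ContinuousOn H (Set.univ ×ˢ Set.Ioo a b) →
      ∀ s ∈ Set.Ioo a b, Continuous fun x => H (x, s) := by
    intro H hH s hs
    exact hH.comp_continuous (by fun_prop) fun x => ⟨Set.mem_univ _, hs⟩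
  obtain ⟨ε, hε, hball⟩ := Metric.nhds_basis_closedBall.mem_iff.1 (isOpen_Ioo.mem_nhds ht)
  obtain ⟨C, hC⟩ := (hK.prod (isCompact_closedBall t ε)).exists_bound_of_continuousOn
    (hG'.mono (Set.prod_mono (Set.subset_univ _) hball))
  refine (hasDerivAt_integral_of_dominated_loc_of_deriv_le (bound := fun _ => C)
    (Metric.closedBall_mem_nhds t hε) (F := fun s x => G (x, s)) (F' := fun s x => G' (x, s))
    ?_ ?_ ?_ ?_ ?_ ?_).2
  · filter_upwards [isOpen_Ioo.mem_nhds ht] with s hs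
    exact (hslice hG s hs).aestronglyMeasurable
  · exact (hslice hG t ht).continuousOn.integrableOn_compact hK
  · exact (hslice hG' t ht).aestronglyMeasurable
  · filter_upwards [ae_restrict_mem hK.measurableSet] with x hx s hs
    exact hC (x, s) ⟨hx, hs⟩
  · exact integrableOn_const hK.measure_lt_top.ne
  · exact Filter.Eventually.of_forall fun x s hs => hderiv x s (hball hs)

theorem ContDiffOn.comp_spaceSlice {F : Type*} [NormedAddCommGroup F] [NormedSpace ℝ F]
    {w : (Fin 3 → ℝ) × ℝ → F} {I : Set ℝ}
    (hw : ContDiffOn ℝ ∞ w (Set.univ ×ˢ I)) {s : ℝ} (hs : s ∈ I) :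
    ContDiff ℝ ∞ fun y => w (y, s) :=
  hw.comp_contDiff (contDiff_prodMk_left s) fun _ => ⟨Set.mem_univ _, hs⟩

section SpaceTime

variable {w : (Fin 3 → ℝ) × ℝ → ℝ} {a b : ℝ}

theorem ContDiffOn.contDiffAt_strip (hw : ContDiffOn ℝ ∞ w (Set.univ ×ˢ Set.Ioo a b))
    (x : Fin 3 → ℝ) {s : ℝ} (hs : s ∈ Set.Ioo a b) : ContDiffAt ℝ ∞ w (x, s) :=
  hw.contDiffAt ((isOpen_univ.prod isOpen_Ioo).mem_nhds ⟨Set.mem_univ _, hs⟩)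

theorem ContDiffOn.fderiv_apply_strip (hw : ContDiffOn ℝ ∞ w (Set.univ ×ˢ Set.Ioo a b))
    (e : (Fin 3 → ℝ) × ℝ) :
    ContDiffOn ℝ ∞ (fun p => fderiv ℝ w p e) (Set.univ ×ˢ Set.Ioo a b) :=
  (hw.fderiv_of_isOpen (isOpen_univ.prod isOpen_Ioo) (m := ∞) (by simp)).clm_apply
    contDiffOn_const

theorem pd_spaceSlice (hw : ContDiffOn ℝ ∞ w (Set.univ ×ˢ Set.Ioo a b)) (i : Fin 3)
    (x : Fin 3 → ℝ) {s : ℝ} (hs : s ∈ Set.Ioo a b) :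
    pd i (fun y => w (y, s)) x = fderiv ℝ w (x, s) (Pi.single i 1, 0) := by
  have h : HasFDerivAt (fun y => w (y, s)) _ x :=
    ((hw.contDiffAt_strip x hs).differentiableAt (by simp)).hasFDerivAt.comp x
      (hasFDerivAt_prodMk_left (𝕜 := ℝ) x s)
  unfold pd
  rw [h.fderiv]
  simp

theorem hasDerivAt_timeSlice (hw : ContDiffOn ℝ ∞ w (Set.univ ×ˢ Set.Ioo a b))
    (x : Fin 3 → ℝ) {s : ℝ} (hs : s ∈ Set.Ioo a b) :
    HasDerivAt (fun r => w (x, r)) (fderiv ℝ w (x, s) (0, 1)) s := by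
  have h := ((hw.contDiffAt_strip x hs).differentiableAt (by simp)).hasFDerivAt.comp s
    (hasFDerivAt_prodMk_right (𝕜 := ℝ) x s)
  simpa [Function.comp_def] using h.hasDerivAt

theorem ContDiffOn.deriv_strip (hw : ContDiffOn ℝ ∞ w (Set.univ ×ˢ Set.Ioo a b)) :
    ContDiffOn ℝ ∞ (fun p : (Fin 3 → ℝ) × ℝ => deriv (fun r => w (p.1, r)) p.2)
      (Set.univ ×ˢ Set.Ioo a b) :=
  (hw.fderiv_apply_strip (0, 1)).congr fun p hp => (hasDerivAt_timeSlice hw p.1 hp.2).deriv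

theorem ContDiffOn.pd_strip (hw : ContDiffOn ℝ ∞ w (Set.univ ×ˢ Set.Ioo a b)) (i : Fin 3) :
    ContDiffOn ℝ ∞ (fun p : (Fin 3 → ℝ) × ℝ => pd i (fun y => w (y, p.2)) p.1)
      (Set.univ ×ˢ Set.Ioo a b) :=
  (hw.fderiv_apply_strip (Pi.single i 1, 0)).congr fun p hp => pd_spaceSlice hw i p.1 hp.2

theorem hasDerivAt_pd_spaceSlice (hw : ContDiffOn ℝ ∞ w (Set.univ ×ˢ Set.Ioo a b)) (i : Fin 3)
    (x : Fin 3 → ℝ) {s : ℝ} (hs : s ∈ Set.Ioo a b) :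
    HasDerivAt (fun r => pd i (fun y => w (y, r)) x)
      (pd i (fun y => deriv (fun r => w (y, r)) s) x) s := by
  have h := hasDerivAt_timeSlice (hw.pd_strip i) x hs
  convert h using 1
  rw [pd_spaceSlice hw.deriv_strip i x hs]
  have hU : Set.univ ×ˢ Set.Ioo a b ∈ nhds (x, s) :=
    (isOpen_univ.prod isOpen_Ioo).mem_nhds ⟨Set.mem_univ _, hs⟩
  have e1 : (fun p : (Fin 3 → ℝ) × ℝ => deriv (fun r => w (p.1, r)) p.2)
      =ᶠ[nhds (x, s)] fun p => fderiv ℝ w p (0, 1) := by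
    filter_upwards [hU] with p hp
    exact (hasDerivAt_timeSlice hw p.1 hp.2).deriv
  have e2 : (fun p : (Fin 3 → ℝ) × ℝ => pd i (fun y => w (y, p.2)) p.1)
      =ᶠ[nhds (x, s)] fun p => fderiv ℝ w p (Pi.single i 1, 0) := by
    filter_upwards [hU] with p hp
    exact pd_spaceSlice hw i p.1 hp.2
  have hC := hw.contDiffAt_strip x hs
  have hd : DifferentiableAt ℝ (fderiv ℝ w) (x, s) :=
    (hC.fderiv_right (m := ∞) (by simp)).differentiableAt (by simp)
  rw [e1.fderiv_eq, e2.fderiv_eq, fderiv_clm_apply hd (differentiableAt_const _),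
    fderiv_clm_apply hd (differentiableAt_const _)]
  simpa using (hC.isSymmSndFDerivAt (by simp; norm_cast)) (Pi.single i 1, 0) (0, 1)

end SpaceTime

/-- Energy production at a fixed time for the mollified Ericksen–Leslie system. Here `A` and `D'`
are the mollified velocity and director, `vt` and `dt` the time derivatives, and `μ` the
variational derivative of the director energy. -/
theorem ericksen_leslie_energy_production {V Z A D D' μ vt dt : Fin 3 → (Fin 3 → ℝ) → ℝ}
    {P : (Fin 3 → ℝ) → ℝ}
    (hV : ∀ k, ContDiff ℝ ∞ (V k)) (hZ : ∀ k, ContDiff ℝ ∞ (Z k)) (hA : ∀ k, ContDiff ℝ ∞ (A k))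
    (hD : ∀ k, ContDiff ℝ ∞ (D k)) (hD' : ∀ k, ContDiff ℝ ∞ (D' k))
    (hdt : ∀ k, ContDiff ℝ ∞ (dt k)) (hP : ContDiff ℝ ∞ P)
    (pV : ∀ k, LatticePeriodic (V k)) (pZ : ∀ k, LatticePeriodic (Z k))
    (pA : ∀ k, LatticePeriodic (A k)) (pD : ∀ k, LatticePeriodic (D k))
    (pdt : ∀ k, LatticePeriodic (dt k)) (pP : LatticePeriodic P)
    (divV : ∀ x, ∑ i, pd i (V i) x = 0) (divZ : ∀ x, ∑ i, pd i (Z i) x = 0)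
    (divA : ∀ x, ∑ i, pd i (A i) x = 0)
    (hμ : ∀ k x, μ k x = (∑ i, pd i (pd i (D k)) x) - 4 * ((∑ l, D l x ^ 2) - 1) * D k x)
    (hmom : ∀ x k, vt k x - (∑ i, pd i (pd i (V k)) x)
      + (∑ i, (Z i x + A i x) * pd i (fun y => Z k y + V k y) x) + pd k P x
      = -∑ m, pd k (D' m) x * μ m x)
    (hdir : ∀ x k, dt k x + (∑ i, (Z i x + V i x) * pd i (D' k) x) = μ k x) :
    ∫ x in Set.Icc (0 : Fin 3 → ℝ) 1,
        ((∑ k, V k x * vt k x) + (∑ i, ∑ k, pd i (D k) x * pd i (dt k) x)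
          + ((∑ m, D m x ^ 2) - 1) * (4 * ∑ m, D m x * dt m x))
      = (∫ x in Set.Icc (0 : Fin 3 → ℝ) 1,
          ∑ k, (∑ i, (Z i x + A i x) * pd i (V k) x) * Z k x)
        + (∫ x in Set.Icc (0 : Fin 3 → ℝ) 1,
          ∑ m, (∑ i, Z i x * pd i (D' m) x) * μ m x)
        - ∫ x in Set.Icc (0 : Fin 3 → ℝ) 1,
          ((∑ i, ∑ k, pd i (V k) x ^ 2) + ∑ k, μ k x ^ 2) := by
  have cV := fun k => (hV k).continuous
  have cZ := fun k => (hZ k).continuous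
  have cA := fun k => (hA k).continuous
  have cD := fun k => (hD k).continuous
  have hpV := fun i k => contDiff_pd (hV k) i
  have hpD := fun i k => contDiff_pd (hD k) i
  have cpV := fun i k => (hpV i k).continuous
  have cpD' := fun i k => (contDiff_pd (hD' k) i).continuous
  have cppD := fun i k => (contDiff_pd (hpD i k) i).continuous
  have cμ : ∀ k, Continuous (μ k) := fun k => by
    rw [funext (hμ k)]
    fun_prop
  have int : ∀ {g : (Fin 3 → ℝ) → ℝ}, Continuous g → IntegrableOn g (Set.Icc 0 1) :=
    fun hg => hg.continuousOn.integrableOn_compact isCompact_Icc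
  let X : Fin 3 → (Fin 3 → ℝ) → ℝ := fun i x =>
    (∑ k, (V k x * pd i (V k) x - (Z i x + A i x) * (V k x * ((1 / 2) * V k x + Z k x))
      + dt k x * pd i (D k) x)) - P x * V i x
  have hX : ∀ i, ContDiff ℝ ∞ (X i) := fun i => by
    have := hpV i
    have := hpD i
    fun_prop
  have pX : ∀ i, LatticePeriodic (X i) := fun i x n => by
    simp only [X, pV _ x n, pZ _ x n, pA _ x n, pdt _ x n, pP x n, (pV _).pd _ x n,
      (pD _).pd _ x n]
  have hdivX : ∀ i x, pd i (X i) x = (∑ k, (V k x * pd i (pd i (V k)) x + pd i (V k) x ^ 2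
      - (Z i x + A i x) * (V k x * pd i (V k) x + V k x * pd i (Z k) x + pd i (V k) x * Z k x)
      - (pd i (Z i) x + pd i (A i) x) * (V k x * ((1 / 2) * V k x + Z k x))
      + dt k x * pd i (pd i (D k)) x + pd i (dt k) x * pd i (D k) x))
      - (P x * pd i (V i) x + pd i P x * V i x) := by
    intro i x
    have := hpV i
    have := hpD i
    have hc : ∀ k x, pd i (fun y => (1 / 2) * V k y) x = (1 / 2) * pd i (V k) x := fun k x => by
      rw [pd_mul contDiff_const (hV k)]
      simp [pd]
    simp only [X]
    rw [pd_sub (by fun_prop) (by fun_prop), pd_mul hP (hV i), pd_sum _ (fun k => by fun_prop)]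
    congr 1
    refine Finset.sum_congr rfl fun k _ => ?_
    rw [pd_add (by fun_prop) (by fun_prop), pd_mul (hdt k) (hpD i k),
      pd_sub (by fun_prop) (by fun_prop), pd_mul (hV k) (hpV i k),
      pd_mul (by fun_prop) (by fun_prop), pd_mul (hV k) (by fun_prop),
      pd_add (by fun_prop) (hZ k), hc, pd_add (hZ i) (hA i)]
    ring
  have hmean := setIntegral_divergence_eq_zero hX pX
  refine Eq.trans ?_ (add_zero _)
  rw [← hmean, ← integral_add (int (by fun_prop)) (int (by fun_prop)),
    ← integral_sub (int (by fun_prop)) (int (by fun_prop)),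
    ← integral_add (int (by fun_prop))
      (int (continuous_finsetSum _ fun i _ => (contDiff_pd (hX i) i).continuous))]
  congr 1
  funext x
  have hZV : ∀ i k, pd i (fun y => Z k y + V k y) x = pd i (Z k) x + pd i (V k) x :=
    fun i k => pd_add (hZ k) (hV k) i x
  have h1 := hmom x
  have h2 := hdir x
  have h3 := divV x
  have h4 := divZ x
  have h5 := divA x
  have h6 := fun k => hμ k x
  simp only [hZV] at h1
  simp only [hdivX]
  simp only [Fin.sum_univ_three] at h1 h2 h3 h4 h5 h6 ⊢
  linear_combination V 0 x * h1 0 + V 1 x * h1 1 + V 2 x * h1 2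
    - μ 0 x * h2 0 - μ 1 x * h2 1 - μ 2 x * h2 2
    + dt 0 x * h6 0 + dt 1 x * h6 1 + dt 2 x * h6 2
    + P x * h3
    + (V 0 x * ((1 / 2) * V 0 x + Z 0 x) + V 1 x * ((1 / 2) * V 1 x + Z 1 x)
      + V 2 x * ((1 / 2) * V 2 x + Z 2 x)) * (h4 + h5)

/-- Global energy equality for the mollified Ericksen–Leslie approximation: for every
`t ∈ (0,T)`,
`(d/dt) ∫ (½|v|² + ½|∇d|² + F(d)) + ∫ (|∇v|² + |Δd−f(d)|²)
  = ∫ ((z+Φ_σ[v])·∇v)·z + ∫ ((z·∇)Φ_σ[d])·(Δd−f(d))`,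
with `F(p) = (|p|²−1)²` and `f(p) = 4(|p|²−1)p`. -/
theorem mollified_ericksen_leslie_energy_equality
    (ψ : (Fin 3 → ℝ) → ℝ) (hψsmooth : ContDiff ℝ (⊤ : ℕ∞) ψ)
    (hψsupp : tsupport ψ ⊆ {x : Fin 3 → ℝ | ∑ i : Fin 3, (x i) ^ 2 ≤ 1})
    (hψint : ∫ x, ψ x = 1)
    (σ : ℝ) (hσ : 0 < σ)
    (T : ℝ) (hT : 0 < T)
    (z v d : (Fin 3 → ℝ) × ℝ → (Fin 3 → ℝ)) (pr : (Fin 3 → ℝ) × ℝ → ℝ)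
    (hz : ContDiffOn ℝ (⊤ : ℕ∞) z (Set.univ ×ˢ Set.Icc 0 T))
    (hv : ContDiffOn ℝ (⊤ : ℕ∞) v (Set.univ ×ˢ Set.Icc 0 T))
    (hd : ContDiffOn ℝ (⊤ : ℕ∞) d (Set.univ ×ˢ Set.Icc 0 T))
    (hpr : ContDiffOn ℝ (⊤ : ℕ∞) pr (Set.univ ×ˢ Set.Icc 0 T))
    (hzper : ∀ (x : Fin 3 → ℝ) (t : ℝ) (n : Fin 3 → ℤ),
      z (x + fun i => (n i : ℝ), t) = z (x, t))
    (hvper : ∀ (x : Fin 3 → ℝ) (t : ℝ) (n : Fin 3 → ℤ),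
      v (x + fun i => (n i : ℝ), t) = v (x, t))
    (hdper : ∀ (x : Fin 3 → ℝ) (t : ℝ) (n : Fin 3 → ℤ),
      d (x + fun i => (n i : ℝ), t) = d (x, t))
    (hprper : ∀ (x : Fin 3 → ℝ) (t : ℝ) (n : Fin 3 → ℤ),
      pr (x + fun i => (n i : ℝ), t) = pr (x, t))
    (hdivv : ∀ (x : Fin 3 → ℝ), ∀ t ∈ Set.Icc (0 : ℝ) T,
      ∑ i : Fin 3, pd i (fun y => v (y, t) i) x = 0)
    (hdivz : ∀ (x : Fin 3 → ℝ), ∀ t ∈ Set.Icc (0 : ℝ) T,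
      ∑ i : Fin 3, pd i (fun y => z (y, t) i) x = 0)
    (hmom : ∀ (x : Fin 3 → ℝ), ∀ t ∈ Set.Ioc (0 : ℝ) T, ∀ k : Fin 3,
      deriv (fun s => v (x, s) k) t
        - (∑ i : Fin 3, pd i (pd i (fun y => v (y, t) k)) x)
        + (∑ i : Fin 3,
            (z (x, t) i + mollify (fun y => σ⁻¹ ^ 3 * ψ (σ⁻¹ • y)) (fun y => v (y, t)) x i)
              * pd i (fun y => z (y, t) k + v (y, t) k) x)
        + pd k (fun y => pr (y, t)) x
      = -(∑ m : Fin 3,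
            pd k (fun y => mollify (fun w => σ⁻¹ ^ 3 * ψ (σ⁻¹ • w)) (fun y' => d (y', t)) y m) x
              * ((∑ i : Fin 3, pd i (pd i (fun y => d (y, t) m)) x)
                  - 4 * ((∑ l : Fin 3, (d (x, t) l) ^ 2) - 1) * d (x, t) m)))
    (hdir : ∀ (x : Fin 3 → ℝ), ∀ t ∈ Set.Ioc (0 : ℝ) T, ∀ k : Fin 3,
      deriv (fun s => d (x, s) k) t
        + (∑ i : Fin 3, (z (x, t) i + v (x, t) i)
            * pd i (fun y => mollify (fun w => σ⁻¹ ^ 3 * ψ (σ⁻¹ • w)) (fun y' => d (y', t)) y k) x)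
      = (∑ i : Fin 3, pd i (pd i (fun y => d (y, t) k)) x)
          - 4 * ((∑ l : Fin 3, (d (x, t) l) ^ 2) - 1) * d (x, t) k) :
    ∀ t ∈ Set.Ioo (0 : ℝ) T,
      HasDerivAt (fun s => ∫ x in Set.Icc (0 : Fin 3 → ℝ) 1,
          ((1 / 2) * (∑ k : Fin 3, (v (x, s) k) ^ 2)
            + (1 / 2) * (∑ i : Fin 3, ∑ k : Fin 3, (pd i (fun y => d (y, s) k) x) ^ 2)
            + ((∑ m : Fin 3, (d (x, s) m) ^ 2) - 1) ^ 2))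
        ((∫ x in Set.Icc (0 : Fin 3 → ℝ) 1,
            ∑ k : Fin 3,
              (∑ i : Fin 3,
                (z (x, t) i + mollify (fun w => σ⁻¹ ^ 3 * ψ (σ⁻¹ • w)) (fun y => v (y, t)) x i)
                  * pd i (fun y => v (y, t) k) x) * z (x, t) k)
          + (∫ x in Set.Icc (0 : Fin 3 → ℝ) 1,
              ∑ m : Fin 3,
                (∑ i : Fin 3, z (x, t) i
                  * pd i (fun y => mollify (fun w => σ⁻¹ ^ 3 * ψ (σ⁻¹ • w)) (fun y' => d (y', t)) y m) x)
                * ((∑ i : Fin 3, pd i (pd i (fun y => d (y, t) m)) x)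
                    - 4 * ((∑ l : Fin 3, (d (x, t) l) ^ 2) - 1) * d (x, t) m))
          - ∫ x in Set.Icc (0 : Fin 3 → ℝ) 1,
              ((∑ i : Fin 3, ∑ k : Fin 3, (pd i (fun y => v (y, t) k) x) ^ 2)
                + ∑ k : Fin 3,
                    ((∑ i : Fin 3, pd i (pd i (fun y => d (y, t) k)) x)
                      - 4 * ((∑ m : Fin 3, (d (x, t) m) ^ 2) - 1) * d (x, t) k) ^ 2))
        t := by
  intro t ht
  have htI : t ∈ Set.Icc (0 : ℝ) T := Set.Ioo_subset_Icc_self ht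
  have htO : t ∈ Set.Ioc (0 : ℝ) T := Set.Ioo_subset_Ioc_self ht
  have hη := contDiff_rescale hψsmooth σ
  have hc := hasCompactSupport_rescale hψsupp hσ
  have hsub : (Set.univ : Set (Fin 3 → ℝ)) ×ˢ Set.Ioo 0 T ⊆ Set.univ ×ˢ Set.Icc 0 T :=
    Set.prod_mono subset_rfl Set.Ioo_subset_Icc_self
  have hvk : ∀ k, ContDiffOn ℝ ∞ (fun p => v p k) (Set.univ ×ˢ Set.Ioo 0 T) :=
    fun k => contDiffOn_pi.1 (hv.mono hsub) k
  have hdk : ∀ k, ContDiffOn ℝ ∞ (fun p => d p k) (Set.univ ×ˢ Set.Ioo 0 T) :=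
    fun k => contDiffOn_pi.1 (hd.mono hsub) k
  have hvt := hv.comp_spaceSlice htI
  have hdt := hd.comp_spaceSlice htI
  have hzt := hz.comp_spaceSlice htI
  have hdtk : ∀ k, ContDiff ℝ ∞ fun y => deriv (fun s => d (y, s) k) t :=
    fun k => (hdk k).deriv_strip.comp_spaceSlice ht
  have key := ericksen_leslie_energy_production
    (V := fun k y => v (y, t) k) (Z := fun k y => z (y, t) k) (D := fun k y => d (y, t) k)
    (A := fun k => fun x => mollify (fun y => σ⁻¹ ^ 3 * ψ (σ⁻¹ • y)) (fun y => v (y, t)) x k)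
    (D' := fun k => fun x => mollify (fun y => σ⁻¹ ^ 3 * ψ (σ⁻¹ • y)) (fun y => d (y, t)) x k)
    (vt := fun k x => deriv (fun s => v (x, s) k) t)
    (dt := fun k x => deriv (fun s => d (x, s) k) t)
    (P := fun y => pr (y, t))
    (contDiff_pi.1 hvt) (contDiff_pi.1 hzt) (contDiff_mollify hη hc hvt.continuous)
    (contDiff_pi.1 hdt) (contDiff_mollify hη hc hdt.continuous) hdtk (hpr.comp_spaceSlice htI)
    (fun k x n => congrFun (hvper x t n) k) (fun k x n => congrFun (hzper x t n) k)
    (latticePeriodic_mollify _ fun x n => hvper x t n)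
    (fun k x n => congrFun (hdper x t n) k) (fun k x n => by simp only [hdper])
    (fun x n => hprper x t n)
    (fun x => hdivv x t htI) (fun x => hdivz x t htI)
    (divergence_mollify_eq_zero hη hc hvt fun x => hdivv x t htI)
    (fun k x => rfl) (fun x k => hmom x t htO k) (fun x k => hdir x t htO k)
  rw [← key]
  have hpd := fun i k => (hdk k).pd_strip i
  have hdv := fun k => (hvk k).deriv_strip
  have hdd := fun k => (hdk k).deriv_strip
  have hpdd := fun i k => (hdd k).pd_strip i
  refine hasDerivAt_setIntegral_of_continuousOn isCompact_Icc
    (G := fun p => (1 / 2) * (∑ k : Fin 3, (v p k) ^ 2)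
      + (1 / 2) * (∑ i : Fin 3, ∑ k : Fin 3, (pd i (fun y => d (y, p.2) k) p.1) ^ 2)
      + ((∑ m : Fin 3, (d p m) ^ 2) - 1) ^ 2)
    (G' := fun p => (∑ k, v p k * deriv (fun s => v (p.1, s) k) p.2)
      + (∑ i, ∑ k, pd i (fun y => d (y, p.2) k) p.1
        * pd i (fun y => deriv (fun s => d (y, s) k) p.2) p.1)
      + ((∑ m, d p m ^ 2) - 1) * (4 * ∑ m, d p m * deriv (fun s => d (p.1, s) m) p.2))
    ?_ ?_ ?_ ht
  · refine ContDiffOn.continuousOn (𝕜 := ℝ) (n := ∞) ?_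
    fun_prop
  · refine ContDiffOn.continuousOn (𝕜 := ℝ) (n := ∞) ?_
    fun_prop
  · intro x s hs
    have h1 : ∀ k, HasDerivAt (fun r => v (x, r) k) (deriv (fun r => v (x, r) k) s) s :=
      fun k => (hasDerivAt_timeSlice (hvk k) x hs).differentiableAt.hasDerivAt
    have h2 : ∀ k, HasDerivAt (fun r => d (x, r) k) (deriv (fun r => d (x, r) k) s) s :=
      fun k => (hasDerivAt_timeSlice (hdk k) x hs).differentiableAt.hasDerivAt
    have h3 := fun i k => hasDerivAt_pd_spaceSlice (hdk k) i x hs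
    refine ((((HasDerivAt.fun_sum fun k (_ : k ∈ Finset.univ) => (h1 k).fun_pow 2).const_mul
      (1 / 2)).add ((HasDerivAt.fun_sum fun i (_ : i ∈ Finset.univ) =>
        HasDerivAt.fun_sum fun k (_ : k ∈ Finset.univ) => (h3 i k).fun_pow 2).const_mul
      (1 / 2))).add (((HasDerivAt.fun_sum fun m (_ : m ∈ Finset.univ) =>
        (h2 m).fun_pow 2).sub_const 1).fun_pow 2)).congr_deriv ?_
    simp only [Fin.sum_univ_three]
    ring
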